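/- arXiv:1603.08493 — 16 statements merged into one kernel-verified Lean document; each statement's English description precedes it below -/
import Mathlib

section
/- Let c be a nonnegative integer such that 10 divides 1024·3^c − c. Then 1024·3^c is a Meertens number in base b = (1024·3^c − c)/10. -/
/-- `M_b(m) = ∏ pᵢ^{dᵢ}`, where `d₁,…,d_n` are the base-`b` digits of `m`
(most significant first, so `d₁ > 0`) and `pᵢ` is the `i`-th prime
(`Nat.nth Nat.Prime (i-1)`). -/
noncomputable def meertensMap (b m : ℕ) : ℕ :=
  ∏ i ∈ Finset.range (Nat.digits b m).length,
    Nat.nth Nat.Prime i ^ ((Nat.digits b m).reverse.getD i 0)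

/-- `m` is a Meertens number in base `b`: `b ≥ 2`, `m > 0` and `M_b(m) = m`. -/
def IsMeertens (b m : ℕ) : Prop :=
  2 ≤ b ∧ 0 < m ∧ meertensMap b m = m

/-- The value of `meertensMap` on a number with exactly two digits `d`, `e` in base `b`. -/
theorem meertensMap_two_digits {b d e : ℕ} (hd : 0 < d) (hdb : d < b) (heb : e < b) :
    meertensMap b (e + b * d) = 2 ^ d * 3 ^ e := by
  have hdigits : Nat.digits b (e + b * d) = [e, d] := by
    rw [Nat.digits_add b (by omega) e d heb (Or.inr hd.ne'), Nat.digits_of_lt b d hd.ne' hdb]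
  simp [meertensMap, hdigits, Finset.prod_range_succ, Nat.nth_prime_zero_eq_two,
    Nat.nth_prime_one_eq_three]

theorem stmt_0 (c : ℕ) (h : 10 ∣ 1024 * 3 ^ c - c) :
    IsMeertens ((1024 * 3 ^ c - c) / 10) (1024 * 3 ^ c) := by
  have hc : c < 3 ^ c := Nat.lt_pow_self (by norm_num)
  obtain ⟨b, hb⟩ := h
  have hm : 1024 * 3 ^ c = c + b * 10 := by omega
  have hquot : (1024 * 3 ^ c - c) / 10 = b := by omega
  refine ⟨by omega, by positivity, ?_⟩
  rw [hquot]
  conv_lhs => rw [hm]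
  rw [meertensMap_two_digits (by norm_num) (by omega) (by omega)]
  norm_num
end

section
/- If a, k and m are positive integers such that a + k·m = 2^a and a < k, then 2^(2^a) is a Meertens number in base 2^k. In particular, for every integer a > 2, 2^(2^a) is a Meertens number in base 2^(2^a − a). -/
theorem meertensMap_pow_mul {b d : ℕ} (m : ℕ) (hb : 1 < b) (hd : 0 < d) (hdb : d < b) :
    meertensMap b (b ^ m * d) = 2 ^ d := by
  unfold meertensMap
  rw [Nat.digits_base_pow_mul hb hd, Nat.digits_of_lt b d hd.ne' hdb]
  simp only [List.length_append, List.length_replicate, List.length_singleton,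
    List.reverse_append, List.reverse_singleton, List.reverse_replicate,
    List.singleton_append, Finset.prod_range_succ', List.getD_cons_zero, List.getD_cons_succ,
    Nat.nth_prime_zero_eq_two]
  rw [Finset.prod_eq_one, one_mul]
  intro i hi
  rw [List.getD_replicate _ (Finset.mem_range.mp hi), pow_zero]

theorem isMeertens_two_pow_two_pow {a k m : ℕ} (hak : a < k) (h : a + k * m = 2 ^ a) :
    IsMeertens (2 ^ k) (2 ^ 2 ^ a) := by
  have hb : 1 < 2 ^ k := Nat.one_lt_two_pow (by omega)
  refine ⟨hb, by positivity, ?_⟩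
  have hfactor : 2 ^ 2 ^ a = (2 ^ k) ^ m * 2 ^ a := by
    rw [← pow_mul, ← pow_add, add_comm, h]
  conv_lhs => rw [hfactor]
  exact meertensMap_pow_mul m hb (by positivity) (Nat.pow_lt_pow_right one_lt_two hak)

theorem two_mul_lt_two_pow {a : ℕ} (ha : 2 < a) : 2 * a < 2 ^ a := by
  induction a, ha using Nat.le_induction with
  | base => norm_num
  | succ n hn ih => rw [pow_succ]; omega

theorem stmt_1 :
    (∀ a k m : ℕ, 0 < a → 0 < k → 0 < m → a + k * m = 2 ^ a → a < k →
      IsMeertens (2 ^ k) (2 ^ 2 ^ a)) ∧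
    (∀ a : ℕ, 2 < a → IsMeertens (2 ^ (2 ^ a - a)) (2 ^ 2 ^ a)) := by
  refine ⟨fun a k m _ _ _ h hak => isMeertens_two_pow_two_pow hak h, fun a ha => ?_⟩
  have := two_mul_lt_two_pow ha
  exact isMeertens_two_pow_two_pow (m := 1) (by omega) (by omega)
end

section
/- Let a be a positive integer and let k > a be a divisor of 2^a − a. Then 2^(2^a) is a Meertens number in base 2^k. -/
/-- The map `meertensMap b` sends `b ^ q * d`, for a nonzero digit `d`, to `2 ^ d`. -/
theorem meertensMap_base_pow_mul_digit {b d : ℕ} (hb : 1 < b) (hd : 0 < d) (hdb : d < b) (q : ℕ) :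
    meertensMap b (b ^ q * d) = 2 ^ d := by
  have hdigits : Nat.digits b (b ^ q * d) = List.replicate q 0 ++ [d] := by
    rw [Nat.digits_base_pow_mul hb hd, Nat.digits_of_lt b d hd.ne' hdb]
  rw [meertensMap, hdigits]
  simp only [List.length_append, List.length_replicate, List.length_singleton,
    List.reverse_append, List.reverse_replicate, List.reverse_singleton, List.singleton_append]
  rw [Finset.prod_range_succ', Finset.prod_eq_one]
  · simp [Nat.nth_prime_zero_eq_two]
  · intro i hi
    simp [Finset.mem_range.mp hi]

theorem stmt_2 (a k : ℕ) (ha : 0 < a) (hak : a < k) (hdvd : k ∣ 2 ^ a - a) :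
    IsMeertens (2 ^ k) (2 ^ 2 ^ a) := by
  obtain ⟨q, hq⟩ := hdvd
  have hpow : 2 ^ a = k * q + a := by
    have := (Nat.lt_two_pow_self : a < 2 ^ a)
    omega
  have hm : 2 ^ 2 ^ a = (2 ^ k) ^ q * 2 ^ a := by
    rw [← pow_mul, ← pow_add, ← hpow]
  have hb : 1 < 2 ^ k := Nat.one_lt_two_pow (by omega)
  refine ⟨hb, by positivity, ?_⟩
  calc meertensMap (2 ^ k) (2 ^ 2 ^ a) = meertensMap (2 ^ k) ((2 ^ k) ^ q * 2 ^ a) := by rw [hm]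
    _ = 2 ^ 2 ^ a := meertensMap_base_pow_mul_digit hb (by positivity)
        (Nat.pow_lt_pow_right one_lt_two hak) q
end

section
/- For integers m ≥ n ≥ 0: (i) 2·3^n is a Meertens number in base 2·3^n − n; (ii) 2^(2^n)·3^(2^m) is a Meertens number in base 2^(2^n − n)·3^(2^m) − 2^(m−n); (iii) 2^(3^n)·3^(3^m) is a Meertens number in base 2^(3^n)·3^(3^m − n) − 3^(m−n). -/
/-- A number `2 ^ a * 3 ^ c` whose base-`b` digits are `a, c` is a Meertens number. -/
theorem isMeertens_of_two_digits {a b c N : ℕ} (ha : 0 < a) (hab : a < b) (hcb : c < b)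
    (hN : N = c + b * a) (h : N = 2 ^ a * 3 ^ c) : IsMeertens b N := by
  have hd : Nat.digits b N = [c, a] := by
    rw [hN, Nat.digits_add b (by omega) c a hcb (Or.inr ha.ne'), Nat.digits_of_lt b a ha.ne' hab]
  refine ⟨by omega, h ▸ by positivity, ?_⟩
  rw [meertensMap, hd, h]
  simp [Finset.prod_range_succ]

theorem two_mul_lt_two_mul_three_pow (k : ℕ) : 2 * k < 2 * 3 ^ k := by
  have := Nat.lt_pow_self (n := k) (by norm_num : 1 < 3)
  omega

theorem isMeertens_two_mul_three_pow (n : ℕ) : IsMeertens (2 * 3 ^ n - n) (2 * 3 ^ n) := by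
  have h := two_mul_lt_two_mul_three_pow n
  have h1 : 0 < 3 ^ n := by positivity
  exact isMeertens_of_two_digits (a := 1) (c := n) one_pos (by omega) (by omega) (by omega)
    (by simp)

/-- If `2 ^ a * 3 ^ c = a * q` and `c = a * r`, then `q - r` is a base in which
`2 ^ a * 3 ^ c` has digits `a, c`, provided that `q` is large. -/
theorem isMeertens_sub {a c q r : ℕ} (ha : 0 < a) (hr : 0 < r) (hq : 2 * c < q)
    (hN : 2 ^ a * 3 ^ c = a * q) (hc : c = a * r) : IsMeertens (q - r) (2 ^ a * 3 ^ c) := by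
  have hac : a ≤ c := hc ▸ Nat.le_mul_of_pos_right a hr
  have hrc : r ≤ c := hc ▸ Nat.le_mul_of_pos_left r ha
  refine isMeertens_of_two_digits ha (by omega) (by omega) ?_ rfl
  obtain ⟨d, rfl⟩ := Nat.exists_eq_add_of_le (show r ≤ q by omega)
  rw [hN, Nat.add_sub_cancel_left, hc]
  ring

theorem two_mul_add_one_le_three_pow (k : ℕ) : 2 * k + 1 ≤ 3 ^ k := by
  induction k with
  | zero => simp
  | succ k ih => rw [pow_succ]; omega

theorem stmt_3 (m n : ℕ) (hnm : n ≤ m) :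
    IsMeertens (2 * 3 ^ n - n) (2 * 3 ^ n) ∧
    IsMeertens (2 ^ (2 ^ n - n) * 3 ^ 2 ^ m - 2 ^ (m - n)) (2 ^ 2 ^ n * 3 ^ 2 ^ m) ∧
    IsMeertens (2 ^ 3 ^ n * 3 ^ (3 ^ m - n) - 3 ^ (m - n)) (2 ^ 3 ^ n * 3 ^ 3 ^ m) := by
  refine ⟨isMeertens_two_mul_three_pow n, ?_, ?_⟩
  · have hn : n < 2 ^ n := Nat.lt_two_pow_self
    refine isMeertens_sub (by positivity) (by positivity) ?_ ?_ ?_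
    · calc 2 * 2 ^ m < 2 * 3 ^ 2 ^ m := two_mul_lt_two_mul_three_pow _
        _ ≤ 2 ^ (2 ^ n - n) * 3 ^ 2 ^ m :=
          Nat.mul_le_mul_right _ (Nat.le_self_pow (by omega) 2)
    · rw [← mul_assoc, ← pow_add, Nat.add_sub_cancel' hn.le]
    · rw [← pow_add, Nat.add_sub_cancel' hnm]
  · have hm := two_mul_add_one_le_three_pow m
    refine isMeertens_sub (by positivity) (by positivity) ?_ ?_ ?_
    · calc 2 * 3 ^ m < 2 * 3 ^ (3 ^ m - n) :=
            Nat.mul_lt_mul_of_pos_left (Nat.pow_lt_pow_right (by norm_num) (by omega)) two_pos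
        _ ≤ 2 ^ 3 ^ n * 3 ^ (3 ^ m - n) :=
          Nat.mul_le_mul_right _ (Nat.le_self_pow (by positivity) 2)
    · rw [mul_left_comm, ← pow_add, Nat.add_sub_cancel' (by omega)]
    · rw [← pow_add, Nat.add_sub_cancel' hnm]
end

section
/- For every integer t ≥ 0, the number 3·2^(2^t + 1) is an α-Meertens number in base b = 3·2^(2^t − t + 1). -/
/-- `N_b(m) = ∏ pᵢ^{dᵢ+1}`, where `d₁,…,d_n` are the base-`b` digits of `m`
(most significant first) and `pᵢ` is the `i`-th prime. -/
noncomputable def alphaMeertensMap (b m : ℕ) : ℕ :=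
  ∏ i ∈ Finset.range (Nat.digits b m).length,
    Nat.nth Nat.Prime i ^ ((Nat.digits b m).reverse.getD i 0 + 1)

/-- `m` is an α-Meertens number in base `b`: `b ≥ 2`, `m > 0` and `N_b(m) = m`. -/
def IsAlphaMeertens (b m : ℕ) : Prop :=
  2 ≤ b ∧ 0 < m ∧ alphaMeertensMap b m = m

theorem two_mul_le_two_pow_add_one (t : ℕ) : 2 * t ≤ 2 ^ t + 1 := by
  induction t with
  | zero => simp
  | succ n ih =>
    rcases n with _ | n
    · simp
    · have := Nat.one_le_two_pow (n := n)
      rw [pow_succ] at *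
      lia

/-- The two-digit number with base-`b` digits `d, 0` has image `3 · 2 ^ (d + 1)`. -/
theorem alphaMeertensMap_mul_of_lt {b d : ℕ} (hb : 2 ≤ b) (hd : d ≠ 0) (hdb : d < b) :
    alphaMeertensMap b (b * d) = 2 ^ (d + 1) * 3 := by
  have hdig : Nat.digits b (b * d) = [0, d] := by
    rw [← zero_add (b * d), Nat.digits_add b hb 0 d (by lia) (Or.inr hd), Nat.digits_of_lt b d hd hdb]
  simp [alphaMeertensMap, hdig, Finset.prod_range_succ]

theorem stmt_4 (t : ℕ) :
    IsAlphaMeertens (3 * 2 ^ (2 ^ t - t + 1)) (3 * 2 ^ (2 ^ t + 1)) := by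
  have hb : 2 ≤ 3 * 2 ^ (2 ^ t - t + 1) := by
    have := Nat.one_le_two_pow (n := 2 ^ t - t + 1)
    lia
  refine ⟨hb, by positivity, ?_⟩
  have hm : 3 * 2 ^ (2 ^ t + 1) = 3 * 2 ^ (2 ^ t - t + 1) * 2 ^ t := by
    rw [mul_assoc, ← pow_add]
    have := t.lt_two_pow_self
    congr 2
    lia
  have hlt : 2 ^ t < 3 * 2 ^ (2 ^ t - t + 1) := by
    have := two_mul_le_two_pow_add_one t
    have : 2 ^ t ≤ 2 ^ (2 ^ t - t + 1) := Nat.pow_le_pow_right two_pos (by lia)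
    have := Nat.two_pow_pos t
    lia
  rw [hm, alphaMeertensMap_mul_of_lt hb (Nat.two_pow_pos t).ne' hlt, ← hm, mul_comm]
end

section
/- For every integer n ≥ 1, the primorial satisfies p_n# > n^(0.5972·n). Moreover, if n ≥ 947, then p_n# > n^(0.980·n). -/
/-- The primorial `p_n# = ∏_{i=1}^n pᵢ`, the product of the first `n` primes. -/
noncomputable def nthPrimorial (n : ℕ) : ℕ :=
  ∏ i ∈ Finset.range n, Nat.nth Nat.Prime i

/-- The product of the first `π(N)` primes is the product of the primes up to `N`. -/
theorem nthPrimorial_primeCounting (N : ℕ) :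
    nthPrimorial (Nat.primeCounting N) = primorial N := by
  have key (M : ℕ) : nthPrimorial (Nat.count Nat.Prime M) =
      ∏ p ∈ Finset.range M with p.Prime, p := by
    induction M with
    | zero => simp [nthPrimorial]
    | succ M ih =>
      rw [Nat.count_succ, Finset.range_add_one, Finset.filter_insert]
      split_ifs with h
      · rw [Finset.prod_insert (by simp), ← ih, nthPrimorial, Finset.prod_range_succ,
          Nat.nth_count h, mul_comm, nthPrimorial]
      · exact ih
  exact key (N + 1)

theorem nthPrimorial_succ (n : ℕ) :
    nthPrimorial (n + 1) = nthPrimorial n * Nat.nth Nat.Prime n :=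
  Finset.prod_range_succ _ _

theorem nthPrimorial_pos (n : ℕ) : 0 < nthPrimorial n :=
  Finset.prod_pos fun i _ => (Nat.prime_nth_prime i).pos

/-- The primorial bound `∏_{p ≤ x} p ≤ 4 ^ x`, read along the sequence of primes. -/
theorem nthPrimorial_le_four_pow_nth (n : ℕ) : nthPrimorial n ≤ 4 ^ Nat.nth Nat.Prime n := by
  have h := nthPrimorial_primeCounting (Nat.nth Nat.Prime n)
  rw [Nat.primeCounting, Nat.primeCounting', Nat.count_nth_succ_of_infinite
    Nat.infinite_setOfPred_prime, nthPrimorial_succ] at h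
  calc nthPrimorial n ≤ nthPrimorial n * Nat.nth Nat.Prime n :=
        Nat.le_mul_of_pos_right _ (Nat.prime_nth_prime n).pos
    _ ≤ 4 ^ Nat.nth Nat.Prime n := h ▸ primorial_le_four_pow _

theorem factorial_succ_le_nthPrimorial (n : ℕ) : (n + 1).factorial ≤ nthPrimorial n := by
  induction n with
  | zero => simp [nthPrimorial]
  | succ n ih =>
    rw [nthPrimorial_succ, Nat.factorial_succ, mul_comm]
    exact Nat.mul_le_mul ih (Nat.add_two_le_nth_prime n)

theorem two_pow_lt_nthPrimorial : 2 ^ 377 < nthPrimorial 64 := by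
  have h : Nat.primeCounting 311 = 64 := by decide +kernel
  rw [← h, nthPrimorial_primeCounting]
  decide +kernel

/-- The bound propagates from `n` to `n + 1`, because `p_n# ≤ 4 ^ p_{n+1}` makes the next prime
large enough. -/
theorem mul_log_lt_log_nthPrimorial {n : ℕ} (hn : 64 ≤ n) :
    0.98 * n * Real.log n < Real.log (nthPrimorial n) := by
  have h2l := Real.log_two_gt_d9
  have h2u := Real.log_two_lt_d9
  have h64 : Real.log 64 = 6 * Real.log 2 := by
    rw [show (64 : ℝ) = 2 ^ 6 by norm_num, Real.log_pow]; norm_num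
  induction n, hn using Nat.le_induction with
  | base =>
    have h : Real.log (2 ^ 377) < Real.log (nthPrimorial 64) :=
      Real.log_lt_log (by positivity) (mod_cast two_pow_lt_nthPrimorial)
    rw [Real.log_pow] at h
    push_cast at h ⊢
    rw [h64]
    linarith
  | succ n hn ih =>
    have hn' : (64 : ℝ) ≤ n := mod_cast hn
    have hn0 : (0 : ℝ) < n := by linarith
    have hL : 6 * Real.log 2 ≤ Real.log n := h64 ▸ Real.log_le_log (by norm_num) hn'
    have hP : (0 : ℝ) < nthPrimorial n := mod_cast nthPrimorial_pos n
    have hq : (0 : ℝ) < Nat.nth Nat.Prime n := mod_cast (Nat.prime_nth_prime n).pos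
    have hlog4 : Real.log 4 = 2 * Real.log 2 := by
      rw [show (4 : ℝ) = 2 ^ 2 by norm_num, Real.log_pow]; norm_num
    have hθ : Real.log (nthPrimorial n) ≤ Nat.nth Nat.Prime n * (2 * Real.log 2) := by
      rw [← hlog4, ← Real.log_pow]
      exact Real.log_le_log hP (mod_cast nthPrimorial_le_four_pow_nth n)
    have hprime : n * Real.exp 1 ≤ Nat.nth Nat.Prime n := by
      have he := Real.exp_one_lt_d9
      have h1 : n * Real.exp 1 ≤ n * 2.72 := by gcongr; linarith
      have h2 : (n : ℝ) * (6 * Real.log 2) ≤ n * Real.log n := by gcongr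
      nlinarith
    have hlogprime : Real.log n + 1 ≤ Real.log (Nat.nth Nat.Prime n) := by
      rw [← Real.log_exp 1, ← Real.log_mul hn0.ne' (Real.exp_pos 1).ne']
      exact Real.log_le_log (by positivity) hprime
    have hstep : ((n : ℝ) + 1) * Real.log (n + 1) ≤ (n + 1) * Real.log n + 1 + 1 / 64 := by
      have h1 : Real.log (n + 1) - Real.log n ≤ 1 / n := by
        rw [← Real.log_div (by positivity) hn0.ne']
        refine (Real.log_le_sub_one_of_pos (by positivity)).trans_eq ?_
        field_simp
        ring
      have h2 : ((n : ℝ) + 1) * (1 / n) ≤ 1 + 1 / 64 := by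
        rw [mul_one_div, div_le_iff₀ hn0]
        linarith
      nlinarith
    rw [nthPrimorial_succ]
    push_cast
    rw [Real.log_mul hP.ne' hq.ne']
    linarith

theorem rpow_lt_nthPrimorial {n : ℕ} (hn : 64 ≤ n) :
    (n : ℝ) ^ (0.980 * (n : ℝ)) < nthPrimorial n := by
  have hn0 : (0 : ℝ) < n := mod_cast (by lia : 0 < n)
  rw [Real.rpow_lt_iff_lt_log hn0 (mod_cast nthPrimorial_pos n)]
  convert mul_log_lt_log_nthPrimorial hn using 2
  norm_num

theorem pow_lt_factorial_succ_pow {n : ℕ} (hn : 1 ≤ n) (hn' : n < 64) :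
    n ^ (3 * n) < (n + 1).factorial ^ 5 := by
  have h : ∀ m < 64, 1 ≤ m → m ^ (3 * m) < (m + 1).factorial ^ 5 := by decide +kernel
  exact h n hn' hn

theorem stmt_5 (n : ℕ) (hn : 1 ≤ n) :
    (n : ℝ) ^ (0.5972 * (n : ℝ)) < (nthPrimorial n : ℝ) ∧
      (947 ≤ n → (n : ℝ) ^ (0.980 * (n : ℝ)) < (nthPrimorial n : ℝ)) := by
  refine ⟨?_, fun h => rpow_lt_nthPrimorial (by lia)⟩
  have hn1 : (1 : ℝ) ≤ n := mod_cast hn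
  rcases lt_or_ge n 64 with h | h
  · have hfive : ((n : ℝ) ^ (0.6 * (n : ℝ))) ^ 5 < (nthPrimorial n : ℝ) ^ 5 := by
      rw [← Real.rpow_mul_natCast (by positivity)]
      have hexp : 0.6 * (n : ℝ) * (5 : ℕ) = (3 * n : ℕ) := by push_cast; ring
      rw [hexp, Real.rpow_natCast]
      exact_mod_cast (pow_lt_factorial_succ_pow hn h).trans_le
        (Nat.pow_le_pow_left (factorial_succ_le_nthPrimorial n) 5)
    refine lt_of_le_of_lt ?_ (lt_of_pow_lt_pow_left₀ 5 (by positivity) hfive)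
    gcongr
    norm_num
  · refine lt_of_le_of_lt ?_ (rpow_lt_nthPrimorial h)
    gcongr
    norm_num
end

section
/- If m is an α-Meertens number in base b whose base-b representation has k digits, then b^k > 2·p_k#. -/
theorem two_mul_nthPrimorial_le_alphaMeertensMap {b m : ℕ} (hm : 0 < m) :
    2 * nthPrimorial (Nat.digits b m).length ≤ alphaMeertensMap b m := by
  have hne : Nat.digits b m ≠ [] := Nat.digits_ne_nil_iff_ne_zero.2 hm.ne'
  have hlead : (Nat.digits b m).reverse.getD 0 0 ≠ 0 := by
    have h := Nat.getLast_digit_ne_zero b hm.ne'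
    rwa [← List.head_reverse (List.reverse_ne_nil_iff.2 hne), List.head_eq_getElem,
      ← List.getD_eq_getElem _ 0] at h
  obtain ⟨n, hn⟩ := Nat.exists_eq_succ_of_ne_zero (List.length_pos_iff.2 hne).ne'
  rw [alphaMeertensMap, nthPrimorial, hn, Finset.prod_range_succ', Finset.prod_range_succ',
    Nat.nth_prime_zero_eq_two, ← mul_assoc, mul_comm 2, mul_assoc]
  refine Nat.mul_le_mul (Finset.prod_le_prod' fun i _ => Nat.le_self_pow (Nat.succ_ne_zero _) _) ?_
  exact (pow_two 2).symm.le.trans (Nat.pow_le_pow_right two_pos (by lia))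

theorem stmt_6 (b m k : ℕ) (hm : IsAlphaMeertens b m)
    (hk : k = (Nat.digits b m).length) :
    2 * nthPrimorial k < b ^ k := by
  obtain ⟨hb, hpos, heq⟩ := hm
  subst hk
  calc 2 * nthPrimorial (Nat.digits b m).length ≤ alphaMeertensMap b m :=
        two_mul_nthPrimorial_le_alphaMeertensMap hpos
    _ = m := heq
    _ < b ^ (Nat.digits b m).length := Nat.lt_base_pow_length_digits hb
end

section
/- If m is an α-Meertens number in base b ≥ 2, then m < b^(b^1.675) (where b^1.675 is a real power). -/
theorem factorial_le_alphaMeertensMap (b m : ℕ) :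
    ((Nat.digits b m).length + 1).factorial ≤ alphaMeertensMap b m := by
  rw [← Finset.prod_range_add_one_eq_factorial, Finset.prod_range_succ', alphaMeertensMap]
  simp only [zero_add, mul_one]
  refine Finset.prod_le_prod' fun i _ => ?_
  calc i + 1 + 1 ≤ Nat.nth Nat.Prime i := Nat.add_two_le_nth_prime i
    _ ≤ _ := Nat.le_self_pow (Nat.succ_ne_zero _) _

theorem pow_le_factorial_of_exp_mul_le {b n : ℕ} (h : Real.exp 1 * b ≤ n) :
    b ^ n ≤ n.factorial := by
  have h1 := Real.pow_div_factorial_le_exp (n : ℝ) (Nat.cast_nonneg n) n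
  rw [div_le_iff₀ (by positivity)] at h1
  have h2 : (Real.exp 1 * b) ^ n ≤ (n : ℝ) ^ n := by gcongr
  rw [mul_pow, ← Real.exp_nat_mul, mul_one] at h2
  exact_mod_cast le_of_mul_le_mul_left (h2.trans h1) (Real.exp_pos _)

theorem pow_le_factorial_succ_of_le {b k n : ℕ} (hbk : b ≤ k + 2)
    (hk : b ^ k ≤ (k + 1).factorial) (hn : k ≤ n) : b ^ n ≤ (n + 1).factorial := by
  induction n, hn using Nat.le_induction with
  | base => exact hk
  | succ n hn ih =>
    rw [pow_succ', Nat.factorial_succ (n + 1)]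
    exact Nat.mul_le_mul (by omega) ih

theorem exp_one_mul_le_rpow {x : ℝ} (hx : 5 ≤ x) : Real.exp 1 * x ≤ x ^ (1.675 : ℝ) := by
  have hlog : 3 / 2 ≤ Real.log x := by
    have h : Real.exp 1 ^ 3 ≤ x ^ 2 :=
      calc Real.exp 1 ^ 3 ≤ 2.72 ^ 3 := by
            gcongr
            linarith [Real.exp_one_lt_d9]
        _ ≤ 5 ^ 2 := by norm_num
        _ ≤ x ^ 2 := by gcongr
    have := Real.log_le_log (by positivity) h
    rw [Real.log_pow, Real.log_pow, Real.log_exp] at this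
    push_cast at this
    linarith
  have hx0 : 0 < x := by linarith
  rw [Real.rpow_def_of_pos hx0]
  nth_rewrite 1 [← Real.exp_log hx0]
  rw [← Real.exp_add, Real.exp_le_exp]
  linarith

theorem pow_le_factorial_succ_of_rpow_lt {b n : ℕ} (hb : 2 ≤ b)
    (h : (b : ℝ) ^ (1.675 : ℝ) < n) : b ^ n ≤ (n + 1).factorial := by
  rcases le_or_gt 5 b with h5 | h5
  · exact (pow_le_factorial_of_exp_mul_le
      ((exp_one_mul_le_rpow (by exact_mod_cast h5)).trans h.le)).trans
      (Nat.factorial_le n.le_succ)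
  · have hb1 : (1 : ℝ) ≤ b := by exact_mod_cast (by omega : 1 ≤ b)
    have hlt : (b : ℝ) ^ (3 / 2 : ℝ) < n :=
      (Real.rpow_le_rpow_of_exponent_le hb1 (by norm_num)).trans_lt h
    have hsq : b ^ 3 < n ^ 2 := by
      have := pow_lt_pow_left₀ hlt (by positivity) two_ne_zero
      rw [← Real.rpow_mul_natCast (by positivity)] at this
      norm_num at this
      exact_mod_cast this
    interval_cases b
    · exact pow_le_factorial_succ_of_le (k := 1) (by norm_num) (by decide) (by nlinarith)
    · exact pow_le_factorial_succ_of_le (k := 4) (by norm_num) (by decide) (by nlinarith)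
    · exact pow_le_factorial_succ_of_le (k := 6) (by norm_num) (by decide) (by nlinarith)

theorem stmt_7 (b m : ℕ) (hb : 2 ≤ b) (hm : IsAlphaMeertens b m) :
    (m : ℝ) < (b : ℝ) ^ ((b : ℝ) ^ (1.675 : ℝ)) := by
  have hlt : m < b ^ (Nat.digits b m).length := Nat.lt_base_pow_length_digits hb
  have hfac := factorial_le_alphaMeertensMap b m
  rw [hm.2.2] at hfac
  have hlen : ((Nat.digits b m).length : ℝ) ≤ (b : ℝ) ^ (1.675 : ℝ) := by
    by_contra! h
    exact (hlt.trans_le ((pow_le_factorial_succ_of_rpow_lt hb h).trans hfac)).false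
  calc (m : ℝ) < (b : ℝ) ^ (Nat.digits b m).length := by exact_mod_cast hlt
    _ = (b : ℝ) ^ ((Nat.digits b m).length : ℝ) := (Real.rpow_natCast _ _).symm
    _ ≤ _ := Real.rpow_le_rpow_of_exponent_le (by exact_mod_cast (by omega : 1 ≤ b)) hlen
end

section
/- Fix an integer b ≥ 2 and let k* be the largest nonnegative integer k such that b^k > 2·p_k# (with k* = 0 if no positive such k exists). Then k* ≤ b^1.675 (real power), and every α-Meertens number m in base b satisfies m < b^(k*). -/
theorem factorial_le_nthPrimorial (n : ℕ) : n.factorial ≤ nthPrimorial n := by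
  induction n with
  | zero => simp [nthPrimorial]
  | succ n ih =>
    rw [nthPrimorial_succ, Nat.factorial_succ, mul_comm]
    exact Nat.mul_le_mul ih (by have := Nat.add_two_le_nth_prime n; lia)

theorem four_pow_le_two_mul_nthPrimorial {n : ℕ} (hn : 4 ≤ n) :
    4 ^ n ≤ 2 * nthPrimorial n := by
  induction n, hn using Nat.le_induction with
  | base =>
    have h : 5 ≤ Nat.nth Nat.Prime 3 := Nat.add_two_le_nth_prime 3
    simp only [nthPrimorial, Finset.prod_range_succ, Finset.prod_range_zero,
      Nat.nth_prime_zero_eq_two, Nat.nth_prime_one_eq_three, Nat.nth_prime_two_eq_five]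
    lia
  | succ n hn ih =>
    have h := Nat.add_two_le_nth_prime n
    rw [nthPrimorial_succ, pow_succ, ← mul_assoc]
    exact Nat.mul_le_mul ih (by lia)

theorem le_exp_one_mul_of_factorial_lt_pow {b k : ℕ} (h : k.factorial < b ^ k) :
    (k : ℝ) ≤ Real.exp 1 * b := by
  rcases Nat.eq_zero_or_pos k with rfl | hk
  · rw [Nat.cast_zero]
    positivity
  have h₁ := Real.pow_div_factorial_le_exp (k : ℝ) k.cast_nonneg k
  rw [div_le_iff₀ (by positivity)] at h₁
  have h₂ : (k.factorial : ℝ) ≤ (b : ℝ) ^ k := by exact_mod_cast h.le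
  refine le_of_pow_le_pow_left₀ hk.ne' (by positivity) (h₁.trans ?_)
  rw [mul_pow, ← Real.exp_nat_mul, mul_one]
  gcongr

theorem exp_one_le_rpow {x : ℝ} (hx : 5 ≤ x) : Real.exp 1 ≤ x ^ (0.675 : ℝ) := by
  have h : (2.7182818286 : ℝ) ≤ 5 ^ (0.675 : ℝ) := by
    refine le_of_pow_le_pow_left₀ (n := 40) (by norm_num) (by positivity) ?_
    rw [← Real.rpow_mul_natCast (by norm_num)]
    norm_num
  exact Real.exp_one_lt_d9.le.trans (h.trans (by gcongr))

theorem le_rpow_of_two_mul_nthPrimorial_lt {b k : ℕ} (hb : 2 ≤ b)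
    (h : 2 * nthPrimorial k < b ^ k) : (k : ℝ) ≤ (b : ℝ) ^ (1.675 : ℝ) := by
  rcases le_or_gt 5 b with hb5 | hb5
  · have hb' : (5 : ℝ) ≤ b := by exact_mod_cast hb5
    have hk := le_exp_one_mul_of_factorial_lt_pow (b := b) (k := k)
      (by have := factorial_le_nthPrimorial k; lia)
    calc (k : ℝ) ≤ Real.exp 1 * b := hk
      _ ≤ (b : ℝ) ^ (0.675 : ℝ) * b := by gcongr; exact exp_one_le_rpow hb'
      _ = (b : ℝ) ^ (1.675 : ℝ) := by
        rw [← Real.rpow_add_one (by positivity)]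
        norm_num
  · have hk : k ≤ 3 := by
      by_contra! hk
      have h₁ := four_pow_le_two_mul_nthPrimorial (n := k) hk
      have h₂ : b ^ k ≤ 4 ^ k := Nat.pow_le_pow_left (by lia) k
      lia
    have h₂ : (3 : ℝ) ≤ 2 ^ (1.675 : ℝ) := by
      refine le_of_pow_le_pow_left₀ (n := 40) (by norm_num) (by positivity) ?_
      rw [← Real.rpow_mul_natCast (by norm_num)]
      norm_num
    calc (k : ℝ) ≤ 3 := by exact_mod_cast hk
      _ ≤ 2 ^ (1.675 : ℝ) := h₂
      _ ≤ (b : ℝ) ^ (1.675 : ℝ) := by gcongr; exact_mod_cast hb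

theorem stmt_8 (b : ℕ) (hb : 2 ≤ b) (kstar : ℕ)
    (hub : ∀ k : ℕ, 2 * nthPrimorial k < b ^ k → k ≤ kstar)
    (hmem : kstar = 0 ∨ 2 * nthPrimorial kstar < b ^ kstar) :
    (kstar : ℝ) ≤ (b : ℝ) ^ (1.675 : ℝ) ∧
      ∀ m : ℕ, IsAlphaMeertens b m → m < b ^ kstar := by
  refine ⟨?_, fun m hm => ?_⟩
  · rcases hmem with rfl | h
    · rw [Nat.cast_zero]
      positivity
    · exact le_rpow_of_two_mul_nthPrimorial_lt hb h
  · obtain ⟨-, hpos, heq⟩ := hm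
    have hlt : m < b ^ (Nat.digits b m).length := Nat.lt_base_pow_length_digits hb
    have hle := two_mul_nthPrimorial_le_alphaMeertensMap (b := b) hpos
    rw [heq] at hle
    exact hlt.trans_le (Nat.pow_le_pow_right (by lia) (hub _ (hle.trans_lt hlt)))
end

section
/- For every integer b with 2 ≤ b ≤ 10000, every α-Meertens number m in base b satisfies m < b^(b−1). If in addition b ≥ 608, then m < b^(b/2) (real power). -/
/-- `x ≥ 2` has no divisor other than itself among the primes up to `43`; a computable
approximation from above to primality, exact for `x < 47 ^ 2`. -/
def isRough (x : ℕ) : Bool :=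
  Nat.ble 2 x && [2, 3, 5, 7, 11, 13, 17, 19, 23, 29, 31, 37, 41, 43].all
    fun d => Nat.ble 1 (x % d) || Nat.beq x d

theorem Nat.Prime.isRough {p : ℕ} (hp : p.Prime) : isRough p = true := by
  have key (d : ℕ) (hd : d ≠ 1) : 1 ≤ p % d ∨ p = d := by
    by_cases h : d ∣ p
    · exact .inr (((Nat.dvd_prime hp).1 h).resolve_left hd).symm
    · exact .inl (Nat.pos_of_ne_zero fun h' => h (Nat.dvd_of_mod_eq_zero h'))
  simp only [_root_.isRough, Bool.and_eq_true, Nat.ble_eq, List.all_eq_true, Bool.or_eq_true,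
    Nat.beq_eq]
  refine ⟨hp.two_le, fun d hd => key d ?_⟩
  rintro rfl
  simp at hd

theorem le_nth_prime_of_count_isRough_le {x n : ℕ} (h : Nat.count (fun i => isRough i) x ≤ n) :
    x ≤ Nat.nth Nat.Prime n :=
  (Nat.count_le_iff_le_nth Nat.infinite_setOfPred_prime).1
    ((Nat.count_mono_left fun _ _ hp => hp.isRough).trans h)

theorem count_isRough_add_le {a l c d : ℕ} (h : Nat.count (fun i => isRough i) a ≤ c)
    (h' : Nat.count (fun i => isRough (a + i)) l ≤ d) :
    Nat.count (fun i => isRough i) (a + l) ≤ c + d := by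
  rw [Nat.count_add]
  exact add_le_add h h'

theorem prod_isRough_le_prod_nth_prime (N : ℕ) :
    ∏ x ∈ Finset.range N, (if isRough x then x else 1) ≤
      ∏ i ∈ Finset.range (Nat.count (fun i => isRough i) N), Nat.nth Nat.Prime i := by
  induction N with
  | zero => simp
  | succ N ih =>
    rw [Finset.prod_range_succ, Nat.count_succ]
    by_cases h : isRough N
    · simp only [h, if_true]
      rw [Finset.prod_range_succ]
      exact Nat.mul_le_mul ih (le_nth_prime_of_count_isRough_le le_rfl)
    · simpa [h] using ih

set_option maxRecDepth 100000 in
theorem mul_two_mul_add_one_le_nth_prime {n : ℕ} (h : 305 ≤ n) (h' : n ≤ 5001) :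
    11 * (2 * n + 1) ≤ 4 * Nat.nth Nat.Prime n := by
  have c₁ : Nat.count (fun i => isRough i) 2017 ≤ 305 := by decide +kernel
  have c₂ := count_isRough_add_le (l := 460) (d := 62) c₁ (by decide +kernel)
  have c₃ := count_isRough_add_le (l := 650) (d := 83) c₂ (by decide +kernel)
  have c₄ := count_isRough_add_le (l := 874) (d := 119) c₃ (by decide +kernel)
  have c₅ := count_isRough_add_le (l := 1146) (d := 158) c₄ (by decide +kernel)
  have c₆ := count_isRough_add_le (l := 1514) (d := 209) c₅ (by decide +kernel)
  have c₇ := count_isRough_add_le (l := 1986) (d := 275) c₆ (by decide +kernel)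
  have c₈ := count_isRough_add_le (l := 2550) (d := 361) c₇ (by decide +kernel)
  have c₉ := count_isRough_add_le (l := 3322) (d := 464) c₈ (by decide +kernel)
  have c₁₀ := count_isRough_add_le (l := 4238) (d := 604) c₉ (by decide +kernel)
  have c₁₁ := count_isRough_add_le (l := 5376) (d := 770) c₁₀ (by decide +kernel)
  have c₁₂ := count_isRough_add_le (l := 3377) (d := 978) c₁₁ (by decide +kernel)
  norm_num only at c₁ c₂ c₃ c₄ c₅ c₆ c₇ c₈ c₉ c₁₀ c₁₁ c₁₂
  have key {x c e : ℕ} (hc : Nat.count (fun i => isRough i) x ≤ c) (hn : c ≤ n) (hn' : n ≤ e)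
      (he : 11 * (2 * e + 1) ≤ 4 * x) : 11 * (2 * n + 1) ≤ 4 * Nat.nth Nat.Prime n := by
    have := le_nth_prime_of_count_isRough_le (hc.trans hn)
    omega
  rcases le_or_gt n 366 with h₁ | h₁
  · exact key c₁ h h₁ (by norm_num)
  rcases le_or_gt n 449 with h₂ | h₂
  · exact key c₂ h₁ h₂ (by norm_num)
  rcases le_or_gt n 568 with h₃ | h₃
  · exact key c₃ h₂ h₃ (by norm_num)
  rcases le_or_gt n 726 with h₄ | h₄
  · exact key c₄ h₃ h₄ (by norm_num)
  rcases le_or_gt n 935 with h₅ | h₅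
  · exact key c₅ h₄ h₅ (by norm_num)
  rcases le_or_gt n 1210 with h₆ | h₆
  · exact key c₆ h₅ h₆ (by norm_num)
  rcases le_or_gt n 1571 with h₇ | h₇
  · exact key c₇ h₆ h₇ (by norm_num)
  rcases le_or_gt n 2035 with h₈ | h₈
  · exact key c₈ h₇ h₈ (by norm_num)
  rcases le_or_gt n 2639 with h₉ | h₉
  · exact key c₉ h₈ h₉ (by norm_num)
  rcases le_or_gt n 3409 with h₁₀ | h₁₀
  · exact key c₁₀ h₉ h₁₀ (by norm_num)
  rcases le_or_gt n 4387 with h₁₁ | h₁₁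
  · exact key c₁₁ h₁₀ h₁₁ (by norm_num)
  · exact key c₁₂ h₁₁ h' (by norm_num)

theorem mul_add_one_le_nth_prime {n : ℕ} (h : 9 ≤ n) (h' : n ≤ 10000) :
    11 * (n + 1) ≤ 4 * Nat.nth Nat.Prime n := by
  have key {e : ℕ} (x c : ℕ) (hn : c ≤ n) (hn' : n ≤ e) (he : 11 * (e + 1) ≤ 4 * x)
      (hc : Nat.count (fun i => isRough i) x ≤ c) : 11 * (n + 1) ≤ 4 * Nat.nth Nat.Prime n := by
    have := le_nth_prime_of_count_isRough_le (hc.trans hn)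
    omega
  rcases le_or_gt n 9 with h₁ | h₁
  · exact key 29 9 h h₁ (by norm_num) (by decide +kernel)
  rcases le_or_gt n 10 with h₂ | h₂
  · exact key 31 10 h₁ h₂ (by norm_num) (by decide +kernel)
  rcases le_or_gt n 12 with h₃ | h₃
  · exact key 37 11 h₂ h₃ (by norm_num) (by decide +kernel)
  rcases le_or_gt n 14 with h₄ | h₄
  · exact key 43 13 h₃ h₄ (by norm_num) (by decide +kernel)
  rcases le_or_gt n 18 with h₅ | h₅
  · exact key 53 15 h₄ h₅ (by norm_num) (by decide +kernel)
  rcases le_or_gt n 24 with h₆ | h₆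
  · exact key 71 19 h₅ h₆ (by norm_num) (by decide +kernel)
  rcases le_or_gt n 35 with h₇ | h₇
  · exact key 101 25 h₆ h₇ (by norm_num) (by decide +kernel)
  rcases le_or_gt n 56 with h₈ | h₈
  · exact key 157 36 h₇ h₈ (by norm_num) (by decide +kernel)
  rcases le_or_gt n 97 with h₉ | h₉
  · exact key 271 57 h₈ h₉ (by norm_num) (by decide +kernel)
  rcases le_or_gt n 189 with h₁₀ | h₁₀
  · exact key 523 98 h₉ h₁₀ (by norm_num) (by decide +kernel)
  rcases le_or_gt n 418 with h₁₁ | h₁₁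
  · exact key 1153 190 h₁₀ h₁₁ (by norm_num) (by decide +kernel)
  rcases le_or_gt n 5001 with h₁₂ | h₁₂
  · have := mul_two_mul_add_one_le_nth_prime (n := n) (by omega) h₁₂
    omega
  · have h₁ := mul_two_mul_add_one_le_nth_prime (n := 5001) (by norm_num) le_rfl
    have h₂ : Nat.nth Nat.Prime 5001 ≤ Nat.nth Nat.Prime n :=
      Nat.nth_monotone Nat.infinite_setOfPred_prime h₁₂.le
    omega

theorem four_mul_add_pow_le {x y k : ℕ} (hx : 0 < x) (h : 100 * (k * y) ≤ 101 * x) :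
    4 * (x + y) ^ k ≤ 11 * x ^ k := by
  have hx' : (0 : ℝ) < x := by exact_mod_cast hx
  have h' : (k : ℝ) * (y / x) ≤ 1 + 1 / 100 := by
    rw [← mul_div_assoc, div_le_iff₀ hx']
    have : (100 : ℝ) * (k * y) ≤ 101 * x := by exact_mod_cast h
    linarith
  have hexp : Real.exp (1 + 1 / 100) ≤ 11 / 4 := by
    have h₁ := Real.exp_one_lt_d9
    have h₂ : Real.exp (1 / 100) ≤ 100 / 99 := by
      have h₃ := Real.add_one_le_exp (-(1 / 100) : ℝ)
      have h₄ : Real.exp (1 / 100) * Real.exp (-(1 / 100)) = 1 := by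
        rw [← Real.exp_add]; simp
      nlinarith [Real.exp_pos (1 / 100)]
    rw [Real.exp_add]
    nlinarith [Real.exp_pos (1 / 100), Real.exp_pos 1]
  have hpow : ((x : ℝ) + y) ^ k ≤ 11 / 4 * x ^ k := calc
    ((x : ℝ) + y) ^ k = ((y : ℝ) / x + 1) ^ k * x ^ k := by
      rw [← mul_pow, add_mul, div_mul_cancel₀ _ hx'.ne', one_mul, add_comm]
    _ ≤ Real.exp (y / x) ^ k * x ^ k := by gcongr; exact Real.add_one_le_exp _
    _ = Real.exp (k * (y / x)) * x ^ k := by rw [Real.exp_nat_mul]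
    _ ≤ 11 / 4 * x ^ k := by gcongr; exact (Real.exp_le_exp.2 h').trans hexp
  have : (4 : ℝ) * (x + y) ^ k ≤ 11 * x ^ k := by linarith
  exact_mod_cast this

theorem pow_self_le_two_mul_prod_nth_prime {b : ℕ} (h : 2 ≤ b) (h' : b ≤ 10000) :
    b ^ b ≤ 2 * ∏ i ∈ Finset.range b, Nat.nth Nat.Prime i := by
  have base {b : ℕ} (N : ℕ) (hN : Nat.count (fun i => isRough i) N = b)
      (hb : b ^ b ≤ 2 * ∏ x ∈ Finset.range N, (if isRough x then x else 1)) :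
      b ^ b ≤ 2 * ∏ i ∈ Finset.range b, Nat.nth Nat.Prime i := by
    have := prod_isRough_le_prod_nth_prime N
    rw [hN] at this
    omega
  rcases le_or_gt b 8 with hb | hb
  · interval_cases b
    · exact base 4 (by decide +kernel) (by decide +kernel)
    · exact base 6 (by decide +kernel) (by decide +kernel)
    · exact base 8 (by decide +kernel) (by decide +kernel)
    · exact base 12 (by decide +kernel) (by decide +kernel)
    · exact base 14 (by decide +kernel) (by decide +kernel)
    · exact base 18 (by decide +kernel) (by decide +kernel)
    · exact base 20 (by decide +kernel) (by decide +kernel)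
  · induction b, Nat.succ_le_of_lt hb using Nat.le_induction with
    | base => exact base 24 (by decide +kernel) (by decide +kernel)
    | succ b h₉ ih =>
      have hp := mul_add_one_le_nth_prime h₉ (by omega)
      have he := four_mul_add_pow_le (x := b) (y := 1) (k := b) (by omega) (by omega)
      rw [Finset.prod_range_succ]
      have := Nat.mul_le_mul (ih (by omega) (by omega) h₉) hp
      have := Nat.mul_le_mul_right (b + 1) he
      rw [pow_succ]
      linarith

set_option maxRecDepth 100000 in
theorem two_mul_sub_one_pow_le_two_mul_prod_nth_prime {k : ℕ} (h : 305 ≤ k) (h' : k ≤ 5001) :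
    (2 * k - 1) ^ k ≤ 2 * ∏ i ∈ Finset.range k, Nat.nth Nat.Prime i := by
  induction k, h using Nat.le_induction with
  | base =>
    have h₁ := prod_isRough_le_prod_nth_prime 2012
    have h₂ : Nat.count (fun i => isRough i) 2012 = 305 := by decide +kernel
    have h₃ : (2 * 305 - 1) ^ 305 ≤
        2 * ∏ x ∈ Finset.range 2012, (if isRough x then x else 1) := by decide +kernel
    rw [h₂] at h₁
    exact h₃.trans (Nat.mul_le_mul_left 2 h₁)
  | succ k hk ih =>
    have hp := mul_two_mul_add_one_le_nth_prime hk (by omega)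
    have he := four_mul_add_pow_le (x := 2 * k - 1) (y := 2) (k := k) (by omega) (by omega)
    rw [show 2 * k - 1 + 2 = 2 * k + 1 by omega] at he
    rw [Finset.prod_range_succ, show 2 * (k + 1) - 1 = 2 * k + 1 by omega, pow_succ]
    have := Nat.mul_le_mul (ih (by omega)) hp
    have := Nat.mul_le_mul_right (2 * k + 1) he
    linarith

theorem two_mul_prod_nth_prime_le_alphaMeertensMap {b m : ℕ} (hm : 0 < m) :
    2 * ∏ i ∈ Finset.range (Nat.digits b m).length, Nat.nth Nat.Prime i ≤
      alphaMeertensMap b m := by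
  have hne : Nat.digits b m ≠ [] := Nat.digits_ne_nil_iff_ne_zero.2 hm.ne'
  obtain ⟨n, hn⟩ := Nat.exists_eq_succ_of_ne_zero (List.length_pos_iff.2 hne).ne'
  have hlead : (Nat.digits b m).reverse.getD 0 0 ≠ 0 := by
    have := Nat.getLast_digit_ne_zero b hm.ne'
    rwa [← List.head_reverse (by simpa using hne), List.head_eq_getElem,
      ← List.getD_eq_getElem (d := 0)] at this
  rw [alphaMeertensMap, hn, Finset.prod_range_succ', Finset.prod_range_succ', mul_comm, mul_assoc]
  refine Nat.mul_le_mul (Finset.prod_le_prod' fun i _ => Nat.le_self_pow (by omega) _) ?_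
  rw [Nat.nth_prime_zero_eq_two]
  calc 2 * 2 = 2 ^ (1 + 1) := by norm_num
    _ ≤ _ := Nat.pow_le_pow_right (by norm_num) (by omega)

theorem IsAlphaMeertens.lt_pow {b m k : ℕ} (hm : IsAlphaMeertens b m)
    (hk : b ^ k ≤ 2 * ∏ i ∈ Finset.range k, Nat.nth Nat.Prime i) (hb : b ≤ Nat.nth Nat.Prime k) :
    m < b ^ (k - 1) := by
  obtain ⟨hb₂, hpos, hfix⟩ := hm
  have hlt : m < b ^ (Nat.digits b m).length := Nat.lt_base_pow_length_digits hb₂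
  have hle := two_mul_prod_nth_prime_le_alphaMeertensMap (b := b) hpos
  rw [hfix] at hle
  suffices (Nat.digits b m).length < k from
    hlt.trans_le (Nat.pow_le_pow_right (by omega) (by omega))
  by_contra! hkn
  refine (hlt.trans_le ?_).not_ge hle
  generalize (Nat.digits b m).length = n at hkn
  induction n, hkn using Nat.le_induction with
  | base => exact hk
  | succ n hn ih =>
    rw [pow_succ, Finset.prod_range_succ, ← mul_assoc]
    exact Nat.mul_le_mul ih (hb.trans (Nat.nth_monotone Nat.infinite_setOfPred_prime hn))

theorem stmt_9 (b m : ℕ) (hb : 2 ≤ b) (hb' : b ≤ 10000)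
    (hm : IsAlphaMeertens b m) :
    m < b ^ (b - 1) ∧ (608 ≤ b → (m : ℝ) < (b : ℝ) ^ ((b : ℝ) / 2)) := by
  refine ⟨hm.lt_pow (pow_self_le_two_mul_prod_nth_prime hb hb') ?_, fun h => ?_⟩
  · have := Nat.add_two_le_nth_prime b
    omega
  · have hp := mul_two_mul_add_one_le_nth_prime (n := b / 2 + 1) (by omega) (by omega)
    have hlt := hm.lt_pow (k := b / 2 + 1)
      ((Nat.pow_le_pow_left (by omega) _).trans
        (two_mul_sub_one_pow_le_two_mul_prod_nth_prime (by omega) (by omega)))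
      (by omega)
    rw [Nat.add_sub_cancel] at hlt
    calc (m : ℝ) < (b : ℝ) ^ (b / 2) := by exact_mod_cast hlt
      _ = (b : ℝ) ^ ((b / 2 : ℕ) : ℝ) := (Real.rpow_natCast _ _).symm
      _ ≤ (b : ℝ) ^ ((b : ℝ) / 2) :=
        Real.rpow_le_rpow_of_exponent_le (by exact_mod_cast (by omega : 1 ≤ b)) Nat.cast_div_le
end

section
/- For every real ε > 0 there exists an integer B such that for all integers b ≥ B, every α-Meertens number m in base b satisfies m < b^(b^(1+ε)) (real power). -/
theorem factorial_length_digits_le_alphaMeertensMap (b m : ℕ) :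
    (Nat.digits b m).length.factorial ≤ alphaMeertensMap b m := by
  rw [← Finset.prod_range_add_one_eq_factorial, alphaMeertensMap]
  refine Finset.prod_le_prod' fun i _ => ?_
  have h := Nat.add_two_le_nth_prime i
  calc i + 1 ≤ Nat.nth Nat.Prime i := by omega
    _ ≤ _ := Nat.le_self_pow (Nat.succ_ne_zero _) _

/-- A base-`b` α-Meertens number has fewer than `e * b` digits. -/
theorem IsAlphaMeertens.length_digits_lt {b m : ℕ} (h : IsAlphaMeertens b m) :
    ((Nat.digits b m).length : ℝ) < b * Real.exp 1 := by
  obtain ⟨hb, -, hm⟩ := h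
  have hlow := factorial_length_digits_le_alphaMeertensMap b m
  have hupp : m < b ^ (Nat.digits b m).length := Nat.lt_base_pow_length_digits hb
  rw [hm] at hlow
  set n := (Nat.digits b m).length
  have hfact : (n.factorial : ℝ) < (b : ℝ) ^ n := mod_cast hlow.trans_lt hupp
  have hexp := Real.pow_div_factorial_le_exp (n : ℝ) n.cast_nonneg n
  rw [div_le_iff₀ (by positivity)] at hexp
  refine lt_of_pow_lt_pow_left₀ n (by positivity) ?_
  calc (n : ℝ) ^ n ≤ Real.exp n * n.factorial := hexp
    _ < Real.exp n * (b : ℝ) ^ n := by gcongr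
    _ = (b * Real.exp 1) ^ n := by rw [mul_pow, ← Real.exp_nat_mul, mul_one, mul_comm]

theorem stmt_11 (ε : ℝ) (hε : 0 < ε) :
    ∃ B : ℕ, ∀ b : ℕ, B ≤ b → ∀ m : ℕ, IsAlphaMeertens b m →
      (m : ℝ) < (b : ℝ) ^ ((b : ℝ) ^ (1 + ε)) := by
  obtain ⟨B, hB⟩ := Filter.eventually_atTop.mp
    (((tendsto_rpow_atTop hε).comp tendsto_natCast_atTop_atTop).eventually_ge_atTop (Real.exp 1))
  refine ⟨B, fun b hBb m hm => ?_⟩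
  have hb : 2 ≤ b := hm.1
  have hexp : Real.exp 1 ≤ (b : ℝ) ^ ε := hB b hBb
  have hlen : ((Nat.digits b m).length : ℝ) ≤ (b : ℝ) ^ (1 + ε) := by
    rw [Real.rpow_add (by positivity), Real.rpow_one]
    exact hm.length_digits_lt.le.trans (by gcongr)
  have hupp : (m : ℝ) < (b : ℝ) ^ (Nat.digits b m).length :=
    mod_cast Nat.lt_base_pow_length_digits hb
  rw [← Real.rpow_natCast] at hupp
  exact hupp.trans_le
    (Real.rpow_le_rpow_of_exponent_le (mod_cast (by omega : 1 ≤ b)) hlen)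
end

section
/- There are no α-Meertens numbers in any base b with 2 ≤ b < 12. -/
/-- The first eleven primes, indexed from `0`. -/
def smallPrime (i : ℕ) : ℕ :=
  [2, 3, 5, 7, 11, 13, 17, 19, 23, 29, 31].getD i 0

theorem nth_prime_eq_smallPrime {i : ℕ} (hi : i < 11) :
    Nat.nth Nat.Prime i = smallPrime i := by
  have key : ∀ i < 11, Nat.Prime (smallPrime i) ∧ Nat.count Nat.Prime (smallPrime i) = i := by
    intro i hi
    interval_cases i <;> simp [smallPrime, Nat.count_succ] <;> norm_num
  obtain ⟨hp, hc⟩ := key i hi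
  simpa only [hc] using Nat.nth_count hp

theorem eleven_pow_le_prod_nth_prime {n : ℕ} (hn : 12 ≤ n) :
    11 ^ n ≤ ∏ i ∈ Finset.range n, Nat.nth Nat.Prime i := by
  have h4 : ∀ i, 4 ≤ i → 11 ≤ Nat.nth Nat.Prime i := fun i hi => by
    simpa [nth_prime_eq_smallPrime, smallPrime] using
      Nat.nth_monotone Nat.infinite_setOfPred_prime hi
  induction n, hn using Nat.le_induction with
  | base =>
    have h11 : 37 ≤ Nat.nth Nat.Prime 11 := by
      have hc : Nat.count Nat.Prime 37 = 11 := by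
        simp [Nat.count_succ]; norm_num
      have := Nat.nth_count (p := Nat.Prime) (n := 37) (by norm_num)
      rw [hc] at this
      exact this.ge
    rw [Finset.prod_range_succ, Finset.prod_congr rfl fun i hi =>
      nth_prime_eq_smallPrime (Finset.mem_range.1 hi)]
    refine le_trans ?_ (Nat.mul_le_mul_left _ h11)
    decide
  | succ n hn ih =>
    rw [pow_succ, Finset.prod_range_succ]
    exact Nat.mul_le_mul ih (h4 n (by omega))

/-- The primorial of the first `n` primes is within a factor `70` of `11 ^ n` for `n < 12`. -/
theorem eleven_pow_le_mul_prod_smallPrime :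
    ∀ n < 12, 11 ^ n ≤ 70 * ∏ i ∈ Finset.range n, smallPrime i := by
  decide +kernel

theorem prod_smallPrime_pow_digits_ne :
    ∀ b < 12, 2 ≤ b → ∀ n < 12, ∀ c < 70,
      (Nat.digits b ((∏ i ∈ Finset.range n, smallPrime i) * c)).length = n →
      ∏ i ∈ Finset.range n, smallPrime i ^
        ((Nat.digits b ((∏ i ∈ Finset.range n, smallPrime i) * c)).reverse.getD i 0 + 1) ≠
        (∏ i ∈ Finset.range n, smallPrime i) * c := by
  decide +kernel

theorem prod_nth_prime_dvd_alphaMeertensMap (b m : ℕ) :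
    ∏ i ∈ Finset.range (Nat.digits b m).length, Nat.nth Nat.Prime i ∣ alphaMeertensMap b m :=
  Finset.prod_dvd_prod_of_dvd _ _ fun _ _ => dvd_pow_self _ (Nat.succ_ne_zero _)

theorem stmt_12 (b m : ℕ) (hb : 2 ≤ b) (hb' : b < 12) :
    ¬ IsAlphaMeertens b m := by
  rintro ⟨-, hm, h⟩
  have hdvd := prod_nth_prime_dvd_alphaMeertensMap b m
  have hlt : m < 11 ^ (Nat.digits b m).length :=
    (Nat.lt_base_pow_length_digits hb).trans_le (Nat.pow_le_pow_left (by omega) _)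
  unfold alphaMeertensMap at h hdvd
  rw [h] at hdvd
  generalize hn : (Nat.digits b m).length = n at h hdvd hlt
  rcases lt_or_ge n 12 with hn12 | hn12
  · have hp : ∀ i ∈ Finset.range n, Nat.nth Nat.Prime i = smallPrime i := fun i hi => by
      exact nth_prime_eq_smallPrime (by have := Finset.mem_range.1 hi; omega)
    rw [Finset.prod_congr rfl hp] at hdvd
    rw [Finset.prod_congr rfl fun i hi => by rw [hp i hi]] at h
    obtain ⟨c, rfl⟩ := hdvd
    have hc : c < 70 := by
      have := hlt.trans_le (eleven_pow_le_mul_prod_smallPrime n hn12)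
      rw [mul_comm 70] at this
      exact lt_of_mul_lt_mul_left' this
    exact prod_smallPrime_pow_digits_ne b hb' hb n hn12 c hc hn h
  · exact absurd (Nat.le_of_dvd hm hdvd)
      (hlt.trans_le (eleven_pow_le_prod_nth_prime hn12)).not_ge
end

section
/- For integers m ≥ n ≥ 0: (i) 3·2^n is a reverse Meertens number in base 3·2^n − n; (ii) 2^(2^m)·3^(2^n) is a reverse Meertens number in base 2^(2^m − n)·3^(2^n) − 2^(m−n); (iii) 2^(3^m)·3^(3^n) is a reverse Meertens number in base 2^(3^m)·3^(3^n − n) − 3^(m−n). -/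
/-- `Mʳ_b(m) = ∏ pᵢ^{d_{n+1-i}}`: the `i`-th prime raised to the `i`-th least
significant base-`b` digit of `m`. -/
noncomputable def revMeertensMap (b m : ℕ) : ℕ :=
  ∏ i ∈ Finset.range (Nat.digits b m).length,
    Nat.nth Nat.Prime i ^ ((Nat.digits b m).getD i 0)

/-- `m` is a reverse Meertens number in base `b`: `b ≥ 2`, `m > 0`, `Mʳ_b(m) = m`. -/
def IsRevMeertens (b m : ℕ) : Prop :=
  2 ≤ b ∧ 0 < m ∧ revMeertensMap b m = m

theorem isRevMeertens_of_two_digits {b q r N : ℕ} (hq : 0 < q) (hqb : q < b) (hrb : r < b)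
    (hN : N = r + b * q) (hpow : N = 2 ^ r * 3 ^ q) : IsRevMeertens b N := by
  have hb : 1 < b := by omega
  have hdigits : Nat.digits b N = [r, q] := by
    rw [hN, Nat.digits_add b hb r q hrb (Or.inr hq.ne'), Nat.digits_of_lt b q hq.ne' hqb]
  refine ⟨hb, by rw [hpow]; positivity, ?_⟩
  simp [revMeertensMap, hdigits, Finset.prod_range_succ, ← hpow]

/-- A number `k * a = 2 ^ (k * c) * 3 ^ k` is a reverse Meertens number in base `a - c`, where its
digits are `k` and `k * c`. -/
theorem isRevMeertens_sub {a c k N : ℕ} (hk : 0 < k) (hc : 0 < c) (hlt : k * c + c < a)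
    (hN : N = k * a) (hpow : N = 2 ^ (k * c) * 3 ^ k) : IsRevMeertens (a - c) N := by
  obtain ⟨b, rfl⟩ := Nat.exists_eq_add_of_lt hlt
  have hkc : k ≤ k * c := Nat.le_mul_of_pos_right k hc
  have hsub : k * c + c + b + 1 - c = k * c + b + 1 := by omega
  rw [hsub]
  refine isRevMeertens_of_two_digits hk (by omega) (by omega) ?_ hpow
  rw [hN]
  ring

theorem stmt_13 (m n : ℕ) (hnm : n ≤ m) :
    IsRevMeertens (3 * 2 ^ n - n) (3 * 2 ^ n) ∧
    IsRevMeertens (2 ^ (2 ^ m - n) * 3 ^ 2 ^ n - 2 ^ (m - n)) (2 ^ 2 ^ m * 3 ^ 2 ^ n) ∧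
    IsRevMeertens (2 ^ 3 ^ m * 3 ^ (3 ^ n - n) - 3 ^ (m - n)) (2 ^ 3 ^ m * 3 ^ 3 ^ n) := by
  have h2n : n < 2 ^ n := Nat.lt_two_pow_self
  have h2m : m < 2 ^ m := Nat.lt_two_pow_self
  have h3n : n < 3 ^ n := Nat.lt_pow_self (by norm_num)
  refine ⟨?_, ?_, ?_⟩
  · refine isRevMeertens_of_two_digits (q := 1) (r := n) ?_ ?_ ?_ ?_ ?_ <;> omega
  · have hexp : 2 ^ n * 2 ^ (m - n) = 2 ^ m := by rw [← pow_add, Nat.add_sub_cancel' hnm]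
    have hsplit : 2 ^ n * 2 ^ (2 ^ m - n) = 2 ^ 2 ^ m := by
      rw [← pow_add, Nat.add_sub_cancel' (by omega)]
    have hle : 2 ^ (m - n) ≤ 2 ^ m := Nat.pow_le_pow_right (by norm_num) (Nat.sub_le m n)
    have hlt : 2 ^ m < 2 ^ 2 ^ m := Nat.lt_two_pow_self
    have hthree : 2 * 2 ^ n ≤ 3 ^ 2 ^ n := by
      obtain ⟨k, hk⟩ := Nat.exists_eq_add_of_lt h2n
      have h : n + k < 3 ^ (n + k) := Nat.lt_pow_self (by norm_num)
      rw [hk, pow_succ]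
      omega
    refine isRevMeertens_sub (k := 2 ^ n) (by positivity) (by positivity) ?_ ?_ (by rw [hexp])
    · calc 2 ^ n * 2 ^ (m - n) + 2 ^ (m - n) < 2 * 2 ^ 2 ^ m := by omega
        _ = 2 ^ (2 ^ m - n) * (2 * 2 ^ n) := by rw [← hsplit]; ring
        _ ≤ 2 ^ (2 ^ m - n) * 3 ^ 2 ^ n := Nat.mul_le_mul_left _ hthree
    · rw [← mul_assoc, hsplit]
  · have hexp : 3 ^ n * 3 ^ (m - n) = 3 ^ m := by rw [← pow_add, Nat.add_sub_cancel' hnm]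
    have hsplit : 3 ^ n * 3 ^ (3 ^ n - n) = 3 ^ 3 ^ n := by
      rw [← pow_add, Nat.add_sub_cancel' h3n.le]
    have hle : 3 ^ (m - n) ≤ 3 ^ m := Nat.pow_le_pow_right (by norm_num) (Nat.sub_le m n)
    have hlt : 3 ^ m < 2 ^ 3 ^ m := Nat.lt_two_pow_self
    have hthree : 3 ≤ 3 ^ (3 ^ n - n) := Nat.le_self_pow (by omega) 3
    refine isRevMeertens_sub (k := 3 ^ n) (by positivity) (by positivity) ?_ ?_ (by rw [hexp])
    · calc 3 ^ n * 3 ^ (m - n) + 3 ^ (m - n) < 2 ^ 3 ^ m * 3 := by omega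
        _ ≤ 2 ^ 3 ^ m * 3 ^ (3 ^ n - n) := Nat.mul_le_mul_left _ hthree
    · rw [mul_left_comm, hsplit]
end

section
/- Let r be a positive integer such that r divides p_{r+1} − 1, where p_{r+1} is the (r+1)-st prime. Then p_{r+1}^(p_{r+1}) is a reverse Meertens number in base b = p_{r+1}^((p_{r+1} − 1)/r). -/
theorem stmt_14 (r : ℕ) (hr : 0 < r)
    (hdvd : r ∣ Nat.nth Nat.Prime r - 1) :
    IsRevMeertens (Nat.nth Nat.Prime r ^ ((Nat.nth Nat.Prime r - 1) / r))
      (Nat.nth Nat.Prime r ^ Nat.nth Nat.Prime r) := by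
  set p := Nat.nth Nat.Prime r with hp_def
  have hp : p.Prime := Nat.prime_nth_prime r
  have hrp : r + 2 ≤ p := Nat.add_two_le_nth_prime r
  obtain ⟨k, hk⟩ := hdvd
  have hk_div : (p - 1) / r = k := by rw [hk, Nat.mul_div_cancel_left k hr]
  have hk_one : 1 < k := by
    by_contra! h
    have : r * k ≤ r * 1 := Nat.mul_le_mul_left r h
    omega
  have hpb : p < p ^ k := lt_self_pow₀ hp.one_lt hk_one
  have hb : 1 < p ^ k := hp.one_lt.trans hpb
  have hm : p ^ p = (p ^ k) ^ r * p := by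
    rw [← pow_mul, ← pow_succ, mul_comm k r, ← hk, Nat.sub_add_cancel hp.one_le]
  have hdigits : Nat.digits (p ^ k) (p ^ p) = List.replicate r 0 ++ [p] := by
    rw [hm, Nat.digits_base_pow_mul hb hp.pos, Nat.digits_of_lt _ _ hp.ne_zero hpb]
  rw [hk_div]
  refine ⟨hb, pow_pos hp.pos p, ?_⟩
  rw [revMeertensMap, hdigits, List.length_append, List.length_replicate, List.length_singleton,
    Finset.prod_range_succ, Finset.prod_eq_one, one_mul]
  · simp [← hp_def]
  · intro i hi
    have hi : i < r := Finset.mem_range.mp hi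
    simp [List.getElem?_append, hi]
end

section
/- Let b ≥ 2 be a squarefree integer and let p_u be the largest prime dividing b (so p_u is the u-th prime). If m is a zeroless Meertens number or a zeroless reverse Meertens number in base b, then m < b^(u−1). -/
/-- `m` is a zeroless Meertens number in base `b`. -/
def IsZerolessMeertens (b m : ℕ) : Prop :=
  IsMeertens b m ∧ 0 ∉ Nat.digits b m

/-- `m` is a zeroless reverse Meertens number in base `b`. -/
def IsZerolessRevMeertens (b m : ℕ) : Prop :=
  IsRevMeertens b m ∧ 0 ∉ Nat.digits b m

/-- A product of prime powers with nonzero exponents over the first `n` primes is divisible by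
every one of those primes. -/
lemma nth_prime_dvd_prod_pow {l : List ℕ} (hl : 0 ∉ l) {k : ℕ} (hk : k < l.length) :
    Nat.nth Nat.Prime k ∣ ∏ i ∈ Finset.range l.length, Nat.nth Nat.Prime i ^ l.getD i 0 := by
  refine dvd_trans (dvd_pow_self _ ?_) (Finset.dvd_prod_of_mem _ (Finset.mem_range.2 hk))
  rw [List.getD_eq_getElem _ _ hk]
  exact fun h => hl (h ▸ List.getElem_mem hk)

lemma not_dvd_of_zero_notMem_digits {b m : ℕ} (hb : 2 ≤ b) (hm : 0 < m)
    (h : 0 ∉ Nat.digits b m) : ¬ b ∣ m := by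
  rintro hd
  rw [Nat.digits_def' (by omega) hm, Nat.mod_eq_zero_of_dvd hd] at h
  simp at h

/-- A squarefree number all of whose prime factors are at most the `k`-th prime divides every
number divisible by the primes up to the `k`-th. -/
lemma Squarefree.dvd_of_nth_prime_dvd {b m k : ℕ} (hsf : Squarefree b)
    (hmax : ∀ p : ℕ, p.Prime → p ∣ b → p ≤ Nat.nth Nat.Prime k)
    (h : ∀ i ≤ k, Nat.nth Nat.Prime i ∣ m) : b ∣ m := by
  rw [← Nat.prod_primeFactors_of_squarefree hsf]
  refine Finset.prod_primes_dvd m (fun p hp => (Nat.prime_of_mem_primeFactors hp).prime) ?_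
  intro p hp
  have hpp := Nat.prime_of_mem_primeFactors hp
  have hle := hmax p hpp (Nat.dvd_of_mem_primeFactors hp)
  rw [← Nat.nth_count hpp] at hle ⊢
  exact h _ ((Nat.nth_le_nth Nat.infinite_setOfPred_prime).1 hle)

theorem stmt_15 (b u m : ℕ) (hb : 2 ≤ b) (hsf : Squarefree b) (hu : 0 < u)
    (hdvd : Nat.nth Nat.Prime (u - 1) ∣ b)
    (hmax : ∀ p : ℕ, p.Prime → p ∣ b → p ≤ Nat.nth Nat.Prime (u - 1))
    (hm : IsZerolessMeertens b m ∨ IsZerolessRevMeertens b m) :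
    m < b ^ (u - 1) := by
  by_contra! hle
  have hlen : u - 1 < (Nat.digits b m).length := (Nat.lt_digits_length_iff (by omega) m).2 hle
  rcases hm with ⟨⟨-, hpos, heq⟩, hz⟩ | ⟨⟨-, hpos, heq⟩, hz⟩ <;>
    refine not_dvd_of_zero_notMem_digits hb hpos hz (hsf.dvd_of_nth_prime_dvd hmax fun i hi => ?_) <;>
    rw [← heq]
  · have := nth_prime_dvd_prod_pow (l := (Nat.digits b m).reverse) (k := i) (by simpa using hz)
      (by rw [List.length_reverse]; omega)
    rwa [List.length_reverse] at this
  · exact nth_prime_dvd_prod_pow hz (by omega)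
end

section
/- Fix an integer b ≥ 2. Let k* be the largest nonnegative integer k with b^k > 2·p_k# and let l* be the largest nonnegative integer l with b^l > p_l# (each taken to be 0 if no positive such integer exists). Then k* ≤ l* ≤ b^1.675 (real power). -/
theorem two_mul_add_one_le_nth_prime {n : ℕ} (hn : 1 ≤ n) :
    2 * n + 1 ≤ Nat.nth Nat.Prime n := by
  induction n, hn using Nat.le_induction with
  | base => simp [Nat.nth_prime_one_eq_three]
  | succ n hn ih =>
    have hlt : Nat.nth Nat.Prime n < Nat.nth Nat.Prime (n + 1) :=
      Nat.nth_strictMono Nat.infinite_setOfPred_prime n.lt_succ_self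
    have h₁ := (Nat.prime_nth_prime n).odd_of_ne_two (by lia)
    have h₂ := (Nat.prime_nth_prime (n + 1)).odd_of_ne_two (by lia)
    obtain ⟨c, hc⟩ := h₁
    obtain ⟨d, hd⟩ := h₂
    lia

theorem add_one_pow_two_mul_le {n : ℕ} (hn : 1 ≤ n) :
    (n + 1) ^ (2 * n) ≤ 8 * n ^ (2 * n) := by
  have hn' : (0 : ℝ) < n := by exact_mod_cast hn
  have hexp : (1 + 1 / (n : ℝ)) ^ (2 * n) ≤ 8 := by
    calc (1 + 1 / (n : ℝ)) ^ (2 * n) ≤ Real.exp (1 / n) ^ (2 * n) := by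
          gcongr
          linarith [Real.add_one_le_exp (1 / (n : ℝ))]
      _ = Real.exp 1 ^ 2 := by
          rw [← Real.exp_nat_mul, ← Real.exp_nat_mul]
          congr 1
          push_cast
          field_simp
      _ ≤ 8 := by nlinarith [Real.exp_one_lt_d9, Real.exp_pos 1]
  have hreal : ((n : ℝ) + 1) ^ (2 * n) ≤ 8 * (n : ℝ) ^ (2 * n) := by
    calc ((n : ℝ) + 1) ^ (2 * n) = (1 + 1 / (n : ℝ)) ^ (2 * n) * (n : ℝ) ^ (2 * n) := by
          rw [← mul_pow]
          congr 1
          field_simp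
      _ ≤ 8 * (n : ℝ) ^ (2 * n) := by gcongr
  exact_mod_cast hreal

theorem pow_two_mul_self_le_nthPrimorial_pow_three (n : ℕ) :
    n ^ (2 * n) ≤ nthPrimorial n ^ 3 := by
  match n with
  | 0 => simp [nthPrimorial]
  | 1 => simp [nthPrimorial, Nat.nth_prime_zero_eq_two]
  | n + 2 =>
    induction n with
    | zero =>
      simp [nthPrimorial, Finset.prod_range_succ, Nat.nth_prime_zero_eq_two,
        Nat.nth_prime_one_eq_three]
    | succ n ih =>
      rw [nthPrimorial_succ, mul_pow]
      calc (n + 2 + 1) ^ (2 * (n + 2 + 1))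
          = (n + 2 + 1) ^ (2 * (n + 2)) * (n + 2 + 1) ^ 2 := by ring
        _ ≤ 8 * (n + 2) ^ (2 * (n + 2)) * (n + 2 + 1) ^ 2 := by
          gcongr
          exact add_one_pow_two_mul_le (by lia)
        _ = (n + 2) ^ (2 * (n + 2)) * (8 * (n + 2 + 1) ^ 2) := by ring
        _ ≤ (n + 2) ^ (2 * (n + 2)) * (2 * (n + 2) + 1) ^ 3 := by
          gcongr
          nlinarith [sq_nonneg n, Nat.zero_le (n ^ 3)]
        _ ≤ nthPrimorial (n + 2) ^ 3 * Nat.nth Nat.Prime (n + 2) ^ 3 := by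
          gcongr
          exact two_mul_add_one_le_nth_prime (by lia)

theorem sq_lt_pow_three_of_nthPrimorial_lt_pow {b l : ℕ} (h : nthPrimorial l < b ^ l) :
    l ^ 2 < b ^ 3 := by
  refine lt_of_pow_lt_pow_left₀ l (Nat.zero_le _) ?_
  calc (l ^ 2) ^ l = l ^ (2 * l) := (pow_mul _ _ _).symm
    _ ≤ nthPrimorial l ^ 3 := pow_two_mul_self_le_nthPrimorial_pow_three l
    _ < (b ^ l) ^ 3 := by gcongr
    _ = (b ^ 3) ^ l := pow_right_comm _ _ _

theorem stmt_16 (b : ℕ) (hb : 2 ≤ b) (kstar lstar : ℕ)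
    (hkub : ∀ k : ℕ, 2 * nthPrimorial k < b ^ k → k ≤ kstar)
    (hkmem : kstar = 0 ∨ 2 * nthPrimorial kstar < b ^ kstar)
    (hlub : ∀ l : ℕ, nthPrimorial l < b ^ l → l ≤ lstar)
    (hlmem : lstar = 0 ∨ nthPrimorial lstar < b ^ lstar) :
    kstar ≤ lstar ∧ (lstar : ℝ) ≤ (b : ℝ) ^ (1.675 : ℝ) := by
  constructor
  · rcases hkmem with rfl | hk
    · exact Nat.zero_le _
    · exact hlub _ (by lia)
  · rcases hlmem with rfl | hl
    · simp only [Nat.cast_zero]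
      positivity
    · have hb1 : (1 : ℝ) ≤ b := by exact_mod_cast (by lia : 1 ≤ b)
      have hsq : (lstar : ℝ) ^ 2 ≤ (b : ℝ) ^ 3 := by
        exact_mod_cast (sq_lt_pow_three_of_nthPrimorial_lt_pow hl).le
      have hpow : ((b : ℝ) ^ (3 / 2 : ℝ)) ^ 2 = (b : ℝ) ^ 3 := by
        rw [← Real.rpow_mul_natCast (by positivity), ← Real.rpow_natCast]
        norm_num
      calc (lstar : ℝ) ≤ (b : ℝ) ^ (3 / 2 : ℝ) :=
            le_of_pow_le_pow_left₀ two_ne_zero (by positivity) (by rwa [hpow])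
        _ ≤ (b : ℝ) ^ (1.675 : ℝ) := Real.rpow_le_rpow_of_exponent_le hb1 (by norm_num)
end
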